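/- arXiv:1606.02044 — 2 statements merged into one kernel-verified Lean document; each statement's English description precedes it below -/
import Mathlib

section
/- For every complex number s ≠ 1, the series Σ_{n=0}^∞ |G_{n+1}| Σ_{k=0}^n (−1)^k C(n,k) (k+1)^{−s} converges and ζ(s) = 1/(s−1) + Σ_{n=0}^∞ |G_{n+1}| Σ_{k=0}^n (−1)^k C(n,k) (k+1)^{−s} (Ser's series for the zeta function with Gregory's coefficients). -/
open Filter Finset intervalIntegral

/-- Gregory's coefficients `G_n = ∫₀¹ x(x−1)⋯(x−n+1)/n! dx`. -/
noncomputable def gregoryG (n : ℕ) : ℝ :=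
  ∫ x in (0:ℝ)..1, (∏ i ∈ Finset.range n, (x - (i : ℝ))) / (n.factorial : ℝ)

open MeasureTheory Topology

/-- The absolute value `x(1−x)⋯(n−x)/(n+1)!` of the integrand of `gregoryG (n + 1)` on `[0, 1]`. -/
noncomputable def gregoryIntegrand (n : ℕ) (x : ℝ) : ℝ :=
  (∏ i ∈ range n, (1 - x / (i + 1))) * (x / (n + 1))

lemma gregoryIntegrand_eq (n : ℕ) (x : ℝ) :
    gregoryIntegrand n x =
      (-1) ^ n * ((∏ i ∈ range (n + 1), (x - (i : ℝ))) / ((n + 1).factorial : ℝ)) := by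
  induction n with
  | zero => simp [gregoryIntegrand]
  | succ n ih =>
    have h : gregoryIntegrand (n + 1) x
        = gregoryIntegrand n x * ((1 - x / (n + 1)) * ((n + 1) / (n + 2))) := by
      simp only [gregoryIntegrand, prod_range_succ]
      push_cast
      field_simp
      ring
    rw [h, ih, prod_range_succ _ (n + 1), Nat.factorial_succ (n + 1)]
    have := Nat.factorial_ne_zero (n + 1)
    push_cast
    field_simp
    ring

lemma gregoryIntegrand_eq_choose (n : ℕ) (x : ℝ) :
    gregoryIntegrand n x = (-1) ^ n * Ring.choose x (n + 1) := by
  rw [gregoryIntegrand_eq, Ring.choose_eq_smul, Polynomial.descPochhammer_smeval_eq_ascPochhammer,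
    Polynomial.ascPochhammer_smeval_cast, Polynomial.ascPochhammer_smeval_eq_eval,
    ← descPochhammer_eval_eq_ascPochhammer, descPochhammer_eval_eq_prod_range]
  simp [div_eq_inv_mul]

lemma continuous_gregoryIntegrand (n : ℕ) : Continuous (gregoryIntegrand n) := by
  unfold gregoryIntegrand; fun_prop

lemma one_sub_div_nonneg {x : ℝ} (hx : x ∈ Set.Icc (0 : ℝ) 1) (i : ℕ) : 0 ≤ 1 - x / (i + 1) := by
  have : x / (i + 1) ≤ 1 := by
    rw [div_le_one (by positivity)]
    linarith [hx.2, (Nat.cast_nonneg i : (0 : ℝ) ≤ i)]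
  linarith

lemma gregoryIntegrand_nonneg (n : ℕ) {x : ℝ} (hx : x ∈ Set.Icc (0 : ℝ) 1) :
    0 ≤ gregoryIntegrand n x :=
  mul_nonneg (prod_nonneg fun i _ => one_sub_div_nonneg hx i) (div_nonneg hx.1 (by positivity))

lemma sum_gregoryIntegrand (N : ℕ) (x : ℝ) :
    ∑ n ∈ range N, gregoryIntegrand n x = 1 - ∏ i ∈ range N, (1 - x / (i + 1)) := by
  induction N with
  | zero => simp
  | succ N ih => rw [sum_range_succ, ih, prod_range_succ, gregoryIntegrand]; ring

lemma sum_gregoryIntegrand_le_one (N : ℕ) {x : ℝ} (hx : x ∈ Set.Icc (0 : ℝ) 1) :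
    ∑ n ∈ range N, gregoryIntegrand n x ≤ 1 := by
  rw [sum_gregoryIntegrand]
  linarith [prod_nonneg fun i (_ : i ∈ range N) => one_sub_div_nonneg hx i]

lemma gregoryIntegrand_le_one (n : ℕ) {x : ℝ} (hx : x ∈ Set.Icc (0 : ℝ) 1) :
    gregoryIntegrand n x ≤ 1 :=
  (single_le_sum (f := fun n => gregoryIntegrand n x)
    (fun i _ => gregoryIntegrand_nonneg i hx) (self_mem_range_succ n)).trans
    (sum_gregoryIntegrand_le_one (n + 1) hx)

lemma abs_gregoryG_succ (n : ℕ) :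
    |gregoryG (n + 1)| = ∫ x in (0:ℝ)..1, gregoryIntegrand n x := by
  have h : ∫ x in (0:ℝ)..1, gregoryIntegrand n x = (-1) ^ n * gregoryG (n + 1) := by
    simp_rw [gregoryIntegrand_eq, intervalIntegral.integral_const_mul, gregoryG]
  have h0 : 0 ≤ ∫ x in (0:ℝ)..1, gregoryIntegrand n x :=
    intervalIntegral.integral_nonneg zero_le_one fun x hx => gregoryIntegrand_nonneg n hx
  rw [← abs_of_nonneg h0, h, abs_mul]
  simp

lemma sum_abs_gregoryG_le_one (N : ℕ) : ∑ n ∈ range N, |gregoryG (n + 1)| ≤ 1 := by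
  simp_rw [abs_gregoryG_succ]
  rw [← intervalIntegral.integral_finsetSum
    fun n _ => (continuous_gregoryIntegrand n).intervalIntegrable 0 1]
  calc _ ≤ ∫ x in (0:ℝ)..1, (1 : ℝ) := by
        refine intervalIntegral.integral_mono_on zero_le_one ?_ (by simp)
          fun x hx => sum_gregoryIntegrand_le_one N hx
        exact (continuous_finsetSum _ fun n _ =>
          continuous_gregoryIntegrand n).intervalIntegrable 0 1
    _ = 1 := by simp

lemma summable_abs_gregoryG : Summable fun n : ℕ => |gregoryG (n + 1)| :=
  summable_of_sum_range_le (fun _ => abs_nonneg _) sum_abs_gregoryG_le_one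

lemma hasSum_gregoryIntegrand_mul_pow (x : ℝ) {u : ℝ} (hu : |u| < 1) :
    HasSum (fun n => gregoryIntegrand n x * u ^ (n + 1)) (1 - (1 - u) ^ x) := by
  have h := (Real.one_add_rpow_hasFPowerSeriesOnBall_zero (a := x)).hasSum (y := -u)
    (by simpa [enorm_eq_nnnorm, ← NNReal.coe_lt_coe] using hu)
  simp only [binomialSeries_apply, smul_eq_mul, List.ofFn_const, List.prod_replicate,
    zero_add] at h
  have h1 := ((hasSum_nat_add_iff' 1).mpr h).neg
  simp only [sum_range_one, Ring.choose_zero_right, pow_zero, mul_one, neg_sub,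
    ← sub_eq_add_neg] at h1
  refine h1.congr_fun fun n => ?_
  rw [gregoryIntegrand_eq_choose, neg_pow u, pow_succ (-1 : ℝ)]
  ring

/-- The generating function of Gregory's coefficients at `1 - exp (-t)`. -/
lemma hasSum_abs_gregoryG_mul_pow {t : ℝ} (ht : 0 < t) :
    HasSum (fun n => |gregoryG (n + 1)| * (1 - Real.exp (-t)) ^ n)
      ((1 - Real.exp (-t))⁻¹ - t⁻¹) := by
  set u := 1 - Real.exp (-t) with hu
  have he : Real.exp (-t) < 1 := by simpa using ht
  have hu0 : 0 < u := by linarith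
  have hu1 : u < 1 := by linarith [Real.exp_pos (-t)]
  have key : HasSum (fun n => ∫ x in (0:ℝ)..1, gregoryIntegrand n x * u ^ (n + 1))
      (∫ x in (0:ℝ)..1, (1 - (1 - u) ^ x)) := by
    have hI : Set.uIoc (0 : ℝ) 1 ⊆ Set.Icc 0 1 := by
      rw [Set.uIoc_of_le zero_le_one]; exact Set.Ioc_subset_Icc_self
    refine intervalIntegral.hasSum_integral_of_dominated_convergence (fun n _ => u ^ (n + 1))
      (fun n => ((continuous_gregoryIntegrand n).mul continuous_const).aestronglyMeasurable)
      (fun n => .of_forall fun x hx => ?_)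
      (.of_forall fun x _ => (summable_nat_add_iff 1).mpr (summable_geometric_of_lt_one hu0.le hu1))
      (by simp) (.of_forall fun x _ =>
        hasSum_gregoryIntegrand_mul_pow x (by rwa [abs_of_pos hu0]))
    rw [norm_mul, Real.norm_of_nonneg (gregoryIntegrand_nonneg n (hI hx)),
      Real.norm_of_nonneg (by positivity)]
    exact mul_le_of_le_one_left (by positivity) (gregoryIntegrand_le_one n (hI hx))
  have hint : ∫ x in (0:ℝ)..1, (1 - (1 - u) ^ x) = 1 - u / t := by
    have h1 : ∀ x : ℝ, (1 - u) ^ x = Real.exp (-t * x) := fun x => by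
      rw [hu, sub_sub_cancel, ← Real.exp_mul]
    simp_rw [h1]
    rw [intervalIntegral.integral_sub (by simp)
      (by apply Continuous.intervalIntegrable; fun_prop),
      intervalIntegral.integral_comp_mul_left _ (neg_ne_zero.mpr ht.ne')]
    simp [hu]
    field_simp
    ring
  rw [hint] at key
  have hval : u⁻¹ - t⁻¹ = u⁻¹ * (1 - u / t) := by field_simp
  rw [hval]
  refine (key.mul_left u⁻¹).congr_fun fun n => ?_
  rw [intervalIntegral.integral_mul_const, ← abs_gregoryG_succ, pow_succ]
  field_simp

/-- The alternating binomial sum `∑ (-1)ᵏ C(n,k) (k+m+1)^{-s}`. -/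
noncomputable def alternatingCpowSum (n m : ℕ) (s : ℂ) : ℂ :=
  ∑ k ∈ range (n + 1), (-1) ^ k * (n.choose k : ℂ) * ((k : ℂ) + m + 1) ^ (-s)

lemma natCast_add_add_one_ne_zero (k m : ℕ) : (k : ℂ) + m + 1 ≠ 0 := by
  exact_mod_cast Nat.succ_ne_zero (k + m)

lemma differentiable_alternatingCpowSum (n m : ℕ) :
    Differentiable ℂ (alternatingCpowSum n m) := by
  unfold alternatingCpowSum
  refine Differentiable.fun_sum fun k _ => (differentiable_const _).mul ?_
  exact differentiable_neg.const_cpow (.inl (natCast_add_add_one_ne_zero k m))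

lemma cpow_neg_eq_mul_cpow (k m : ℕ) (s : ℂ) :
    ((k : ℂ) + m + 1) ^ (-s) = ((k : ℂ) + m + 1) * ((k : ℂ) + m + 1) ^ (-(s + 1)) := by
  rw [show -s = 1 + -(s + 1) by ring, Complex.cpow_add _ _ (natCast_add_add_one_ne_zero k m),
    Complex.cpow_one]

lemma alternatingCpowSum_zero (m : ℕ) (s : ℂ) :
    alternatingCpowSum 0 m s = (m + 1) * alternatingCpowSum 0 m (s + 1) := by
  have := cpow_neg_eq_mul_cpow 0 m s
  simpa [alternatingCpowSum] using this

lemma alternatingCpowSum_succ (n m : ℕ) (s : ℂ) :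
    alternatingCpowSum (n + 1) m s = (m + 1) * alternatingCpowSum (n + 1) m (s + 1)
      - (n + 1) * alternatingCpowSum n (m + 1) (s + 1) := by
  have h1 : alternatingCpowSum (n + 1) m s = (m + 1) * alternatingCpowSum (n + 1) m (s + 1)
      + ∑ k ∈ range (n + 1 + 1), (-1) ^ k * ((n + 1).choose k : ℂ) * k *
        ((k : ℂ) + m + 1) ^ (-(s + 1)) := by
    simp only [alternatingCpowSum, mul_sum]
    rw [← sum_add_distrib]
    refine sum_congr rfl fun k _ => ?_
    rw [cpow_neg_eq_mul_cpow]
    ring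
  rw [h1, sub_eq_add_neg, sum_range_succ', alternatingCpowSum, alternatingCpowSum,
    mul_sum _ _ ((n : ℂ) + 1), ← sum_neg_distrib]
  simp only [Nat.cast_zero, mul_zero, zero_mul, add_zero]
  congr 1
  refine sum_congr rfl fun k _ => ?_
  have h : ((n : ℂ) + 1) * n.choose k = (n + 1).choose (k + 1) * (k + 1) := by
    exact_mod_cast Nat.add_one_mul_choose_eq n k
  have hb : ((k + 1 : ℕ) : ℂ) + m + 1 = (k : ℂ) + (m + 1 : ℕ) + 1 := by push_cast; ring
  rw [hb, pow_succ]
  push_cast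
  linear_combination (-1) ^ k * ((k : ℂ) + (m + 1) + 1) ^ (-(s + 1)) * h

/-- The function whose Mellin transform is `Γ(s)` times `alternatingCpowSum n m s`. -/
noncomputable def alternatingKernel (n m : ℕ) (t : ℝ) : ℝ :=
  Real.exp (-((m + 1) * t)) * (1 - Real.exp (-t)) ^ n

lemma continuous_alternatingKernel (n m : ℕ) : Continuous (alternatingKernel n m) := by
  unfold alternatingKernel; fun_prop

lemma alternatingKernel_nonneg (n m : ℕ) {t : ℝ} (ht : 0 < t) : 0 ≤ alternatingKernel n m t := by
  have : Real.exp (-t) < 1 := by simpa using ht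
  exact mul_nonneg (Real.exp_pos _).le (pow_nonneg (by linarith) n)

lemma alternatingKernel_eq_sum (n m : ℕ) (t : ℝ) :
    alternatingKernel n m t =
      ∑ k ∈ range (n + 1), (-1) ^ k * (n.choose k : ℝ) * Real.exp (-(k + m + 1) * t) := by
  rw [alternatingKernel, sub_eq_neg_add, add_pow, mul_sum]
  refine sum_congr rfl fun k _ => ?_
  rw [show -((k : ℝ) + m + 1) * t = -((m + 1) * t) + k * (-t) by ring, Real.exp_add,
    Real.exp_nat_mul, neg_pow (Real.exp (-t))]
  ring

lemma Gamma_mul_alternatingCpowSum (n m : ℕ) {s : ℂ} (hs : 0 < s.re) :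
    Complex.Gamma s * alternatingCpowSum n m s =
      mellin (fun t => (alternatingKernel n m t : ℂ)) s := by
  have h := hasSum_mellin (ι := Fin (n + 1)) (s := s)
    (a := fun k => (-1) ^ (k : ℕ) * (n.choose k : ℂ)) (p := fun k => (k : ℝ) + m + 1)
    (F := fun t => (alternatingKernel n m t : ℂ)) (fun k => .inr (by positivity)) hs
    (fun t _ => ?_) (hasSum_fintype _).summable
  · rw [← h.tsum_eq, tsum_fintype, Fin.sum_univ_eq_sum_range (fun k => Complex.Gamma s *
      ((-1) ^ k * (n.choose k : ℂ)) / (((k : ℝ) + m + 1 : ℝ) : ℂ) ^ s), alternatingCpowSum, mul_sum]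
    refine sum_congr rfl fun k _ => ?_
    rw [Complex.cpow_neg]
    push_cast
    ring
  · have hsum : (alternatingKernel n m t : ℂ) = ∑ k : Fin (n + 1), (-1) ^ (k : ℕ) *
        (n.choose k : ℂ) * (Real.exp (-((k : ℝ) + m + 1) * t) : ℂ) := by
      rw [Fin.sum_univ_eq_sum_range (fun k => (-1) ^ k * (n.choose k : ℂ) *
        (Real.exp (-((k : ℝ) + m + 1) * t) : ℂ)), alternatingKernel_eq_sum]
      push_cast
      rfl
    rw [hsum]
    exact hasSum_fintype _

lemma norm_mellin_integrand_le {f : ℝ → ℂ} {C : ℝ} (hf : ∀ t, 0 < t → ‖f t‖ ≤ C * Real.exp (-t))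
    (s : ℂ) {t : ℝ} (ht : 0 < t) :
    ‖(t : ℂ) ^ (s - 1) • f t‖ ≤ C * (Real.exp (-t) * t ^ (s.re - 1)) := by
  rw [norm_smul, Complex.norm_cpow_eq_rpow_re_of_pos ht, Complex.sub_re, Complex.one_re]
  calc _ ≤ t ^ (s.re - 1) * (C * Real.exp (-t)) :=
        mul_le_mul_of_nonneg_left (hf t ht) (Real.rpow_nonneg ht.le _)
    _ = _ := by ring

lemma integrableOn_const_mul_exp_neg_mul_rpow (C : ℝ) {σ : ℝ} (hσ : 0 < σ) :
    IntegrableOn (fun t => C * (Real.exp (-t) * t ^ (σ - 1))) (Set.Ioi 0) :=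
  (Real.GammaIntegral_convergent hσ).const_mul C

lemma norm_mellin_le_of_norm_le_exp {f : ℝ → ℂ} {C : ℝ}
    (hf : ∀ t, 0 < t → ‖f t‖ ≤ C * Real.exp (-t)) {s : ℂ} (hs : 0 < s.re) :
    ‖mellin f s‖ ≤ C * Real.Gamma s.re := by
  rw [Real.Gamma_eq_integral hs, ← MeasureTheory.integral_const_mul, mellin]
  exact norm_integral_le_of_norm_le (integrableOn_const_mul_exp_neg_mul_rpow C hs)
    ((ae_restrict_iff' measurableSet_Ioi).mpr
      (.of_forall fun t ht => norm_mellin_integrand_le hf s ht))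

lemma integral_norm_mellin_integrand_le {f : ℝ → ℂ} {C : ℝ}
    (hf : ∀ t, 0 < t → ‖f t‖ ≤ C * Real.exp (-t)) {s : ℂ} (hs : 0 < s.re) :
    ∫ t in Set.Ioi (0 : ℝ), ‖(t : ℂ) ^ (s - 1) • f t‖ ≤ C * Real.Gamma s.re := by
  rw [Real.Gamma_eq_integral hs, ← MeasureTheory.integral_const_mul]
  refine integral_mono_of_nonneg (.of_forall fun t => norm_nonneg _)
    (integrableOn_const_mul_exp_neg_mul_rpow C hs) ((ae_restrict_iff' measurableSet_Ioi).mpr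
      (.of_forall fun t ht => norm_mellin_integrand_le hf s ht))

lemma mellinConvergent_of_norm_le_exp {f : ℝ → ℂ} {C : ℝ} (hfc : ContinuousOn f (Set.Ioi 0))
    (hf : ∀ t, 0 < t → ‖f t‖ ≤ C * Real.exp (-t)) {s : ℂ} (hs : 0 < s.re) :
    MellinConvergent f s := by
  refine (integrableOn_const_mul_exp_neg_mul_rpow C hs).mono' ?_
    ((ae_restrict_iff' measurableSet_Ioi).mpr
      (.of_forall fun t ht => norm_mellin_integrand_le hf s ht))
  refine ContinuousOn.aestronglyMeasurable (ContinuousOn.fun_smul (fun t ht => ?_) hfc)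
    measurableSet_Ioi
  exact (Complex.continuousAt_ofReal_cpow_const t (s - 1)
    (.inr (ne_of_gt ht))).continuousWithinAt

lemma pow_mul_alternatingKernel_le (n m : ℕ) {t : ℝ} (ht : 0 < t) :
    ((n : ℝ) + 1) ^ m * alternatingKernel n m t
      ≤ m.factorial * Real.exp 1 * Real.exp (-t) := by
  set y := Real.exp (-t) with hy
  have hy0 : 0 < y := Real.exp_pos _
  have hy1 : y ≤ 1 := by simpa [hy] using ht.le
  have hk : alternatingKernel n m t = y ^ (m + 1) * (1 - y) ^ n := by
    rw [alternatingKernel, hy, ← Real.exp_nat_mul]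
    push_cast
    ring_nf
  have h1 : (1 - y) ^ n ≤ Real.exp (-(n * y)) := by
    calc (1 - y) ^ n ≤ Real.exp (-y) ^ n :=
          pow_le_pow_left₀ (by linarith) (Real.one_sub_le_exp_neg y) n
      _ = _ := by rw [← Real.exp_nat_mul]; ring_nf
  have h2 : (((n : ℝ) + 1) * y) ^ m ≤ m.factorial * Real.exp ((n + 1) * y) := by
    have := Real.pow_div_factorial_le_exp (x := ((n : ℝ) + 1) * y) (by positivity) m
    rwa [div_le_iff₀' (by positivity)] at this
  calc ((n : ℝ) + 1) ^ m * alternatingKernel n m t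
      = y * ((((n : ℝ) + 1) * y) ^ m * (1 - y) ^ n) := by rw [hk, mul_pow]; ring
    _ ≤ y * ((m.factorial * Real.exp ((n + 1) * y)) * Real.exp (-(n * y))) := by
        have : 0 ≤ (1 - y) ^ n := pow_nonneg (by linarith) n
        gcongr
    _ = y * (m.factorial * Real.exp y) := by
        rw [mul_assoc (m.factorial : ℝ), ← Real.exp_add]; ring_nf
    _ ≤ y * (m.factorial * Real.exp 1) := by gcongr
    _ = _ := by ring

lemma pow_mul_norm_alternatingCpowSum_le (n m : ℕ) {s : ℂ} (hs : 0 < s.re) :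
    ((n : ℝ) + 1) ^ m * ‖alternatingCpowSum n m s‖
      ≤ m.factorial * Real.exp 1 * Real.Gamma s.re / ‖Complex.Gamma s‖ := by
  have hG : 0 < ‖Complex.Gamma s‖ := norm_pos_iff.mpr (Complex.Gamma_ne_zero_of_re_pos hs)
  have h := norm_mellin_le_of_norm_le_exp (f := fun t => (alternatingKernel n m t : ℂ))
    (C := m.factorial * Real.exp 1 / ((n : ℝ) + 1) ^ m) (fun t ht => ?_) hs
  · rw [← Gamma_mul_alternatingCpowSum n m hs, norm_mul, div_mul_eq_mul_div,
      le_div_iff₀ (by positivity)] at h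
    rw [le_div_iff₀ hG]
    linarith
  · rw [Complex.norm_real, Real.norm_of_nonneg (alternatingKernel_nonneg n m ht),
      div_mul_eq_mul_div, le_div_iff₀ (by positivity)]
    linarith [pow_mul_alternatingKernel_le n m ht]

lemma eventually_pow_mul_norm_alternatingCpowSum_le_of_re_pos (m : ℕ) {s₀ : ℂ} (hs : 0 < s₀.re) :
    ∃ C : ℝ, ∀ᶠ s in 𝓝 s₀, ∀ n : ℕ, ((n : ℝ) + 1) ^ m * ‖alternatingCpowSum n m s‖ ≤ C := by
  have hre : ∀ᶠ s : ℂ in 𝓝 s₀, 0 < s.re :=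
    Complex.continuous_re.continuousAt.eventually (lt_mem_nhds hs)
  have hc : ContinuousAt
      (fun s : ℂ => m.factorial * Real.exp 1 * Real.Gamma s.re / ‖Complex.Gamma s‖) s₀ := by
    refine ContinuousAt.div (continuousAt_const.mul ?_) ?_
      (norm_ne_zero_iff.mpr (Complex.Gamma_ne_zero_of_re_pos hs))
    · exact ContinuousAt.comp (f := Complex.re) (Real.differentiableAt_Gamma fun k => by
        have : (0 : ℝ) ≤ k := k.cast_nonneg
        linarith).continuousAt Complex.continuous_re.continuousAt
    · exact (Complex.differentiableAt_Gamma s₀ fun k hk => by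
        have : (0 : ℝ) ≤ k := k.cast_nonneg
        simp [hk] at hs
        linarith).continuousAt.norm
  refine ⟨m.factorial * Real.exp 1 * Real.Gamma s₀.re / ‖Complex.Gamma s₀‖ + 1, ?_⟩
  filter_upwards [hre, hc.eventually (gt_mem_nhds (lt_add_one _))] with s hs hlt n
  exact (pow_mul_norm_alternatingCpowSum_le n m hs).trans hlt.le

lemma eventually_pow_mul_norm_alternatingCpowSum_le (j m : ℕ) {s₀ : ℂ} (hs : 0 < s₀.re + j) :
    ∃ C : ℝ, ∀ᶠ s in 𝓝 s₀, ∀ n : ℕ, ((n : ℝ) + 1) ^ m * ‖alternatingCpowSum n m s‖ ≤ C := by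
  induction j generalizing m s₀ with
  | zero => exact eventually_pow_mul_norm_alternatingCpowSum_le_of_re_pos m (by simpa using hs)
  | succ j ih =>
    have hs' : 0 < (s₀ + 1).re + j := by
      push_cast at hs
      simp only [Complex.add_re, Complex.one_re]
      linarith
    obtain ⟨C₁, h₁⟩ := ih m hs'
    obtain ⟨C₂, h₂⟩ := ih (m + 1) hs'
    have ht : Tendsto (fun s : ℂ => s + 1) (𝓝 s₀) (𝓝 (s₀ + 1)) :=
      (continuous_add_const 1).tendsto s₀
    refine ⟨(m + 1) * C₁ + 2 ^ m * C₂, ?_⟩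
    filter_upwards [ht.eventually h₁, ht.eventually h₂] with s b₁ b₂ n
    have hC₂ : 0 ≤ C₂ := le_trans (by positivity) (b₂ 0)
    have hm : ‖(m : ℂ) + 1‖ = m + 1 := by exact_mod_cast Complex.norm_natCast (m + 1)
    cases n with
    | zero =>
      have := b₁ 0
      rw [alternatingCpowSum_zero, norm_mul, hm]
      simp only [Nat.cast_zero, zero_add, one_pow, one_mul] at this ⊢
      nlinarith [mul_le_mul_of_nonneg_left this (by positivity : (0 : ℝ) ≤ m + 1),
        mul_nonneg (by positivity : (0 : ℝ) ≤ 2 ^ m) hC₂]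
    | succ n =>
      have hn : ‖(n : ℂ) + 1‖ = n + 1 := by exact_mod_cast Complex.norm_natCast (n + 1)
      have hpow : ((n + 1 : ℕ) + 1 : ℝ) ^ m ≤ 2 ^ m * ((n : ℝ) + 1) ^ m := by
        rw [← mul_pow]
        push_cast
        gcongr
        linarith [(n.cast_nonneg : (0 : ℝ) ≤ n)]
      set A := ‖alternatingCpowSum (n + 1) m (s + 1)‖
      set B := ‖alternatingCpowSum n (m + 1) (s + 1)‖
      have hAB : ‖alternatingCpowSum (n + 1) m s‖ ≤ (m + 1) * A + (n + 1) * B := by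
        rw [alternatingCpowSum_succ]
        refine (norm_sub_le _ _).trans_eq ?_
        rw [norm_mul, norm_mul, hm, hn]
      calc ((n + 1 : ℕ) + 1 : ℝ) ^ m * ‖alternatingCpowSum (n + 1) m s‖
          ≤ ((n + 1 : ℕ) + 1 : ℝ) ^ m * ((m + 1) * A + (n + 1) * B) := by gcongr
        _ = (m + 1) * (((n + 1 : ℕ) + 1 : ℝ) ^ m * A)
            + ((n + 1 : ℕ) + 1 : ℝ) ^ m * ((n + 1) * B) := by ring
        _ ≤ (m + 1) * C₁ + 2 ^ m * ((n : ℝ) + 1) ^ m * ((n + 1) * B) := by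
            gcongr
            exact b₁ (n + 1)
        _ = (m + 1) * C₁ + 2 ^ m * (((n : ℝ) + 1) ^ (m + 1) * B) := by ring
        _ ≤ (m + 1) * C₁ + 2 ^ m * C₂ := by
            gcongr
            exact b₂ n

lemma eventually_norm_alternatingCpowSum_le (s₀ : ℂ) :
    ∃ C : ℝ, ∀ᶠ s in 𝓝 s₀, ∀ n : ℕ, ‖alternatingCpowSum n 0 s‖ ≤ C := by
  obtain ⟨j, hj⟩ := exists_nat_gt (-s₀.re)
  simpa using eventually_pow_mul_norm_alternatingCpowSum_le j 0 (s₀ := s₀) (by linarith)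

/-- The generating function of Gregory's coefficients in the variable `1 - exp (-t)`,
times `exp (-t)`. -/
noncomputable def gregoryKernel (t : ℝ) : ℝ :=
  Real.exp (-t) * ((1 - Real.exp (-t))⁻¹ - t⁻¹)

lemma one_sub_exp_neg_pos {t : ℝ} (ht : 0 < t) : 0 < 1 - Real.exp (-t) := by
  have : Real.exp (-t) < 1 := by simpa using ht
  linarith

lemma hasSum_gregoryKernel {t : ℝ} (ht : 0 < t) :
    HasSum (fun n => |gregoryG (n + 1)| * alternatingKernel n 0 t) (gregoryKernel t) := by
  refine ((hasSum_abs_gregoryG_mul_pow ht).mul_left (Real.exp (-t))).congr_fun fun n => ?_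
  simp only [alternatingKernel, Nat.cast_zero, zero_add, one_mul]
  ring

lemma gregoryKernel_nonneg {t : ℝ} (ht : 0 < t) : 0 ≤ gregoryKernel t :=
  (hasSum_gregoryKernel ht).nonneg fun n =>
    mul_nonneg (abs_nonneg _) (alternatingKernel_nonneg n 0 ht)

lemma gregoryKernel_le {t : ℝ} (ht : 0 < t) : gregoryKernel t ≤ 1 * Real.exp (-t) := by
  refine le_of_tendsto' (hasSum_gregoryKernel ht).tendsto_sum_nat fun N => ?_
  calc ∑ n ∈ range N, |gregoryG (n + 1)| * alternatingKernel n 0 t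
      ≤ ∑ n ∈ range N, |gregoryG (n + 1)| * Real.exp (-t) := by
        gcongr with n
        simp only [alternatingKernel, Nat.cast_zero, zero_add, one_mul]
        refine mul_le_of_le_one_right (Real.exp_pos _).le
          (pow_le_one₀ (one_sub_exp_neg_pos ht).le ?_)
        linarith [Real.exp_pos (-t)]
    _ ≤ 1 * Real.exp (-t) := by
        rw [← sum_mul]
        exact mul_le_mul_of_nonneg_right (sum_abs_gregoryG_le_one N) (Real.exp_pos _).le

lemma mellinConvergent_gregoryKernel {s : ℂ} (hs : 0 < s.re) :
    MellinConvergent (fun t => (gregoryKernel t : ℂ)) s := by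
  refine mellinConvergent_of_norm_le_exp (C := 1) ?_ (fun t ht => ?_) hs
  · refine Complex.continuous_ofReal.comp_continuousOn ?_
    unfold gregoryKernel
    refine ContinuousOn.mul (by fun_prop) (ContinuousOn.sub ?_ ?_)
    · exact ContinuousOn.inv₀ (by fun_prop) fun t ht => (one_sub_exp_neg_pos ht).ne'
    · exact ContinuousOn.inv₀ (by fun_prop) fun t ht => ne_of_gt ht
  · rw [Complex.norm_real, Real.norm_of_nonneg (gregoryKernel_nonneg ht)]
    exact gregoryKernel_le ht

lemma hasSum_mellin_gregoryKernel {s : ℂ} (hs : 0 < s.re) :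
    HasSum
      (fun n => Complex.Gamma s * (Complex.ofReal |gregoryG (n + 1)| * alternatingCpowSum n 0 s))
      (mellin (fun t => (gregoryKernel t : ℂ)) s) := by
  have hbound (n : ℕ) (t : ℝ) (ht : 0 < t) :
      ‖Complex.ofReal |gregoryG (n + 1)| * (alternatingKernel n 0 t : ℂ)‖
        ≤ |gregoryG (n + 1)| * Real.exp 1 * Real.exp (-t) := by
    rw [norm_mul, Complex.norm_real, Complex.norm_real, Real.norm_eq_abs, abs_abs,
      Real.norm_of_nonneg (alternatingKernel_nonneg n 0 ht), mul_assoc]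
    have := pow_mul_alternatingKernel_le n 0 ht
    simp only [pow_zero, one_mul, Nat.factorial_zero, Nat.cast_one] at this
    gcongr
  have h := hasSum_integral_of_summable_integral_norm (μ := volume.restrict (Set.Ioi (0 : ℝ)))
    (F := fun (n : ℕ) (t : ℝ) => (t : ℂ) ^ (s - 1) •
      (Complex.ofReal |gregoryG (n + 1)| * (alternatingKernel n 0 t : ℂ)))
    (fun n => mellinConvergent_of_norm_le_exp (C := |gregoryG (n + 1)| * Real.exp 1)
      (by have := continuous_alternatingKernel n 0; fun_prop) (hbound n) hs)
    (((summable_abs_gregoryG.mul_right (Real.exp 1)).mul_right (Real.Gamma s.re)).of_nonneg_of_le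
      (fun n => integral_nonneg fun t => norm_nonneg _)
      (fun n => integral_norm_mellin_integrand_le (hbound n) hs))
  have hf : mellin (fun t => (gregoryKernel t : ℂ)) s =
      ∫ t in Set.Ioi (0 : ℝ), ∑' n : ℕ, (t : ℂ) ^ (s - 1) •
        (Complex.ofReal |gregoryG (n + 1)| * (alternatingKernel n 0 t : ℂ)) := by
    refine setIntegral_congr_fun measurableSet_Ioi fun t ht => ?_
    have h1 := (Complex.hasSum_ofReal.mpr (hasSum_gregoryKernel ht)).const_smul
      ((t : ℂ) ^ (s - 1))
    simp only [Complex.ofReal_mul] at h1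
    exact h1.tsum_eq.symm
  rw [hf]
  refine h.congr_fun fun n => ?_
  rw [mul_left_comm, Gamma_mul_alternatingCpowSum n 0 hs, mellin,
    ← MeasureTheory.integral_const_mul]
  refine integral_congr_ae (.of_forall fun t => ?_)
  simp only [smul_eq_mul]
  ring

lemma mellin_exp_neg_mul_inv_one_sub_exp_neg {s : ℂ} (hs : 1 < s.re) :
    mellin (fun t => ((Real.exp (-t) * (1 - Real.exp (-t))⁻¹ : ℝ) : ℂ)) s =
      Complex.Gamma s * riemannZeta s := by
  have hs0 : 0 < s.re := zero_lt_one.trans hs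
  have h := hasSum_mellin (s := s) (a := fun _ : ℕ => 1) (p := fun n => (n : ℝ) + 1)
    (F := fun t => ((Real.exp (-t) * (1 - Real.exp (-t))⁻¹ : ℝ) : ℂ))
    (fun n => .inr (by positivity)) hs0 (fun t ht => ?_) ?_
  · rw [← h.tsum_eq, zeta_eq_tsum_one_div_nat_add_one_cpow hs, ← tsum_mul_left]
    refine tsum_congr fun n => ?_
    push_cast
    ring
  · have hlt : Real.exp (-t) < 1 := by simpa using ht
    have hg := (hasSum_geometric_of_lt_one (Real.exp_pos (-t)).le hlt).mul_left (Real.exp (-t))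
    refine (Complex.hasSum_ofReal.mpr hg).congr_fun fun n => ?_
    rw [one_mul, ← pow_succ', ← Real.exp_nat_mul]
    push_cast
    ring_nf
  · have := (summable_nat_add_iff 1).mpr (Real.summable_one_div_nat_rpow.mpr hs)
    simpa using this

lemma hasMellin_exp_neg_mul_inv {s : ℂ} (hs : 1 < s.re) :
    HasMellin (fun t => ((Real.exp (-t) * t⁻¹ : ℝ) : ℂ)) s (Complex.Gamma (s - 1)) := by
  have hs' : 0 < (s - 1).re := by simpa using hs
  have heq : Set.EqOn (fun t : ℝ => (Real.exp (-t) : ℂ) * (t : ℂ) ^ (s - 1 - 1))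
      (fun t : ℝ => (t : ℂ) ^ (s - 1) • ((Real.exp (-t) * t⁻¹ : ℝ) : ℂ)) (Set.Ioi 0) := by
    intro t ht
    have ht0 : (t : ℂ) ≠ 0 := Complex.ofReal_ne_zero.mpr (ne_of_gt ht)
    simp only [smul_eq_mul, Complex.cpow_sub _ _ ht0, Complex.cpow_one]
    push_cast
    field_simp
  refine ⟨(Complex.GammaIntegral_convergent hs').congr_fun heq measurableSet_Ioi, ?_⟩
  rw [Complex.Gamma_eq_integral hs', Complex.GammaIntegral]
  exact (setIntegral_congr_fun measurableSet_Ioi heq).symm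

lemma mellin_gregoryKernel {s : ℂ} (hs : 1 < s.re) :
    mellin (fun t => (gregoryKernel t : ℂ)) s =
      Complex.Gamma s * (riemannZeta s - 1 / (s - 1)) := by
  have hs0 : 0 < s.re := zero_lt_one.trans hs
  have hs1 : s - 1 ≠ 0 := fun h => by simp [sub_eq_zero.mp h] at hs
  have hexp := hasMellin_exp_neg_mul_inv hs
  have hadd := (hasMellin_add (mellinConvergent_gregoryKernel hs0) hexp.1).2
  have hfun : (fun t => (gregoryKernel t : ℂ) + ((Real.exp (-t) * t⁻¹ : ℝ) : ℂ)) =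
      fun t => ((Real.exp (-t) * (1 - Real.exp (-t))⁻¹ : ℝ) : ℂ) := by
    ext t
    rw [gregoryKernel]
    push_cast
    ring
  rw [hfun, mellin_exp_neg_mul_inv_one_sub_exp_neg hs, hexp.2] at hadd
  have hG := Complex.Gamma_add_one (s - 1) hs1
  rw [sub_add_cancel] at hG
  have : Complex.Gamma s * (1 / (s - 1)) = Complex.Gamma (s - 1) := by
    rw [hG]; field_simp
  rw [mul_sub, this, hadd, add_sub_cancel_right]

lemma tsum_gregoryG_mul_alternatingCpowSum_of_one_lt_re {s : ℂ} (hs : 1 < s.re) :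
    ∑' n, Complex.ofReal |gregoryG (n + 1)| * alternatingCpowSum n 0 s =
      riemannZeta s - 1 / (s - 1) := by
  have hs0 : 0 < s.re := zero_lt_one.trans hs
  have h := (hasSum_mellin_gregoryKernel hs0).tsum_eq
  rw [tsum_mul_left, mellin_gregoryKernel hs] at h
  exact mul_left_cancel₀ (Complex.Gamma_ne_zero_of_re_pos hs0) h

lemma norm_gregoryG_mul_alternatingCpowSum_le {s : ℂ} {C : ℝ} {n : ℕ}
    (h : ‖alternatingCpowSum n 0 s‖ ≤ C) :
    ‖Complex.ofReal |gregoryG (n + 1)| * alternatingCpowSum n 0 s‖ ≤ |gregoryG (n + 1)| * C := by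
  rw [norm_mul, Complex.norm_real, Real.norm_eq_abs, abs_abs]
  gcongr

lemma summable_gregoryG_mul_alternatingCpowSum (s : ℂ) :
    Summable fun n => Complex.ofReal |gregoryG (n + 1)| * alternatingCpowSum n 0 s := by
  obtain ⟨C, hC⟩ := eventually_norm_alternatingCpowSum_le s
  exact (summable_abs_gregoryG.mul_right C).of_norm_bounded
    fun n => norm_gregoryG_mul_alternatingCpowSum_le (hC.self_of_nhds n)

lemma differentiable_tsum_gregoryG_mul_alternatingCpowSum :
    Differentiable ℂ fun s =>
      ∑' n, Complex.ofReal |gregoryG (n + 1)| * alternatingCpowSum n 0 s := by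
  intro s₀
  obtain ⟨C, hC⟩ := eventually_norm_alternatingCpowSum_le s₀
  obtain ⟨U, hU, hUo, hsU⟩ := eventually_nhds_iff.mp hC
  exact (Complex.differentiableOn_tsum_of_summable_norm (summable_abs_gregoryG.mul_right C)
    (fun n => ((differentiable_alternatingCpowSum n 0).const_mul _).differentiableOn) hUo
    fun n w hw => norm_gregoryG_mul_alternatingCpowSum_le (hU w hw n)).differentiableAt
    (hUo.mem_nhds hsU)

lemma tsum_gregoryG_mul_alternatingCpowSum {s : ℂ} (hs : s ≠ 1) :
    ∑' n, Complex.ofReal |gregoryG (n + 1)| * alternatingCpowSum n 0 s =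
      riemannZeta s - 1 / (s - 1) := by
  have hopen : IsOpen ({1}ᶜ : Set ℂ) := isOpen_compl_singleton
  have hf : AnalyticOnNhd ℂ
      (fun s => ∑' n, Complex.ofReal |gregoryG (n + 1)| * alternatingCpowSum n 0 s) {1}ᶜ :=
    differentiable_tsum_gregoryG_mul_alternatingCpowSum.differentiableOn.analyticOnNhd hopen
  have hg : AnalyticOnNhd ℂ (fun s => riemannZeta s - 1 / (s - 1)) {1}ᶜ := by
    refine DifferentiableOn.analyticOnNhd (fun z hz => ?_) hopen
    have hz1 : z - 1 ≠ 0 := sub_ne_zero.mpr hz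
    exact ((differentiableAt_riemannZeta hz).sub ((differentiableAt_const _).div
      (differentiableAt_id.sub_const 1) hz1)).differentiableWithinAt
  refine hf.eqOn_of_preconnected_of_eventuallyEq hg
    (isConnected_compl_singleton_of_one_lt_rank (by simp) 1).isPreconnected
    (z₀ := 2) (by simp) ?_ hs
  have hre : ∀ᶠ s : ℂ in 𝓝 2, 1 < s.re :=
    Complex.continuous_re.continuousAt.eventually (lt_mem_nhds (by simp))
  filter_upwards [hre] with s hs using tsum_gregoryG_mul_alternatingCpowSum_of_one_lt_re hs

/-- Ser's series for the zeta function with Gregory's coefficients: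
for every `s ≠ 1`, the series `Σ_{n=0}^∞ |G_{n+1}| Σ_{k=0}^n (−1)^k C(n,k) (k+1)^{−s}`
converges and `ζ(s) = 1/(s−1) + Σ_{n=0}^∞ |G_{n+1}| Σ_{k=0}^n (−1)^k C(n,k) (k+1)^{−s}`. -/
theorem ser_gregory_series_zeta (s : ℂ) (hs : s ≠ 1) :
    ∃ L : ℂ,
      Tendsto (fun N : ℕ => ∑ n ∈ Finset.range N, (Complex.ofReal |gregoryG (n + 1)|) *
          ∑ k ∈ Finset.range (n + 1), (-1) ^ k * (n.choose k : ℂ) * ((k : ℂ) + 1) ^ (-s))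
        atTop (nhds L) ∧
      riemannZeta s = 1 / (s - 1) + L := by
  refine ⟨_, ?_, (add_sub_cancel (1 / (s - 1)) (riemannZeta s)).symm⟩
  rw [← tsum_gregoryG_mul_alternatingCpowSum hs]
  simpa [alternatingCpowSum] using
    (summable_gregoryG_mul_alternatingCpowSum s).hasSum.tendsto_sum_nat
end

section
/- For every integer m ≥ 0, the Stieltjes constant γ_m satisfies γ_m = −(1/(m+1)) Σ_{n=0}^∞ (1/(n+1)) Σ_{k=0}^n (−1)^k C(n,k) (ln(k+1))^{m+1}, the outer series being convergent. -/
open Filter Finset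

section HasseSeries

open MeasureTheory

/-- The `j`-th derivative in `s` of the `n`-th term
`(1/(n+1)) Σ_{k ≤ n} (-1)^k C(n,k) (k+1)^(1-s)` of Hasse's series for `(s-1) ζ(s)`. -/
noncomputable def hasseTerm (j n : ℕ) (s : ℂ) : ℂ :=
  (1 / ((n : ℂ) + 1)) * ∑ k ∈ Finset.range (n + 1), (-1) ^ k * (n.choose k : ℂ) *
    ((-Complex.ofReal (Real.log ((k : ℝ) + 1))) ^ j *
      Complex.exp (-Complex.ofReal (Real.log ((k : ℝ) + 1)) * (s - 1)))

lemma hasDerivAt_hasseTerm (j n : ℕ) (s : ℂ) :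
    HasDerivAt (hasseTerm j n) (hasseTerm (j + 1) n s) s := by
  unfold hasseTerm
  refine HasDerivAt.const_mul _ (HasDerivAt.fun_sum fun k _ => HasDerivAt.const_mul _ ?_)
  rw [pow_succ, mul_assoc]
  refine HasDerivAt.const_mul _ ?_
  have h := (((hasDerivAt_id s).sub_const 1).const_mul
    (-Complex.ofReal (Real.log ((k : ℝ) + 1)))).cexp
  simpa [mul_comm] using h

lemma hasseTerm_zero (n : ℕ) (s : ℂ) :
    hasseTerm 0 n s = (1 / ((n : ℂ) + 1)) * ∑ k ∈ Finset.range (n + 1),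
      (-1) ^ k * (n.choose k : ℂ) * (((k : ℝ) + 1 : ℝ) : ℂ) ^ (1 - s) := by
  unfold hasseTerm
  congr 1
  refine Finset.sum_congr rfl fun k _ => ?_
  have hk : (0 : ℝ) < (k : ℝ) + 1 := by positivity
  rw [Complex.cpow_def_of_ne_zero (by exact_mod_cast hk.ne'), Complex.ofReal_log hk.le]
  simp only [pow_zero, one_mul]
  congr 2
  ring

lemma sum_hasseTerm_deriv_tendsto {U : Set ℂ} (hU : IsOpen U) {f : ℂ → ℂ}
    (h : TendstoLocallyUniformlyOn (fun N s => ∑ n ∈ Finset.range N, hasseTerm 0 n s) f atTop U)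
    (j : ℕ) :
    TendstoLocallyUniformlyOn (fun N s => ∑ n ∈ Finset.range N, hasseTerm j n s)
      (iteratedDeriv j f) atTop U := by
  induction j with
  | zero => simpa using h
  | succ j ih =>
    have hd (N : ℕ) (s : ℂ) := HasDerivAt.fun_sum (u := Finset.range N)
      fun n _ => hasDerivAt_hasseTerm j n s
    have := ih.deriv (.of_forall fun N s _ => (hd N s).differentiableAt.differentiableWithinAt) hU
    rw [iteratedDeriv_succ]
    convert this using 1
    ext N s
    exact (hd N s).deriv.symm

lemma summable_integral_of_sum_range_le {α : Type*} [MeasurableSpace α] {μ : Measure α}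
    {F : ℕ → α → ℝ} {b : α → ℝ} (hF : ∀ n, AEStronglyMeasurable (F n) μ)
    (h0 : ∀ n, ∀ᵐ a ∂μ, 0 ≤ F n a) (hb : Integrable b μ)
    (hs : ∀ N, ∀ᵐ a ∂μ, ∑ n ∈ Finset.range N, F n a ≤ b a) :
    (∀ n, Integrable (F n) μ) ∧ Summable fun n => ∫ a, F n a ∂μ := by
  have hi (n : ℕ) : Integrable (F n) μ := by
    refine hb.mono' (hF n) ?_
    filter_upwards [ae_all_iff.2 h0, hs (n + 1)] with a h1 h2
    rw [Real.norm_of_nonneg (h1 n)]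
    rw [Finset.sum_range_succ] at h2
    linarith [Finset.sum_nonneg fun i (_ : i ∈ Finset.range n) => h1 i]
  refine ⟨hi, summable_of_sum_range_le (c := ∫ a, b a ∂μ)
    (fun n => integral_nonneg_of_ae (h0 n)) fun N => ?_⟩
  rw [← integral_finsetSum _ fun n _ => hi n]
  exact integral_mono_ae (integrable_finsetSum _ fun n _ => hi n) hb (hs N)

lemma integrableOn_rpow_mul_exp_neg_mul_add {σ : ℝ} (hσ : 0 < σ) (c : ℝ) :
    IntegrableOn (fun t : ℝ => t ^ (σ - 1) * (Real.exp (-t) * (c + t))) (Set.Ioi 0) := by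
  have h1 := (Real.GammaIntegral_convergent hσ).const_mul c
  have h2 := Real.GammaIntegral_convergent (s := σ + 1) (by linarith)
  refine IntegrableOn.congr_fun (h1.add h2) (fun t ht => ?_) measurableSet_Ioi
  have : t ^ (σ + 1 - 1) = t ^ (σ - 1) * t := by
    rw [← Real.rpow_add_one (ne_of_gt ht)]; ring_nf
  simp only [Pi.add_apply, this]
  ring

lemma mul_exp_neg_div_le {t : ℝ} (ht : 0 < t) : t / (1 - Real.exp (-t)) ≤ 1 + t := by
  have h1 : Real.exp (-t) < 1 := by simpa using ht
  rw [div_le_iff₀ (by linarith)]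
  have h2 : (1 + t) * Real.exp (-t) ≤ 1 := by
    rw [Real.exp_neg, ← div_eq_mul_inv, div_le_one (Real.exp_pos t)]
    linarith [Real.add_one_le_exp t]
  linarith

lemma hasSum_one_sub_exp_neg_pow_div {t : ℝ} (ht : 0 < t) :
    HasSum (fun n : ℕ => (1 - Real.exp (-t)) ^ n / ((n : ℝ) + 1))
      (t / (1 - Real.exp (-t))) := by
  have h1 : Real.exp (-t) < 1 := by simpa using ht
  have h2 := Real.exp_pos (-t)
  have h := (Real.hasSum_pow_div_log_of_abs_lt_one (x := 1 - Real.exp (-t))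
    (by rw [abs_lt]; constructor <;> linarith)).div_const (1 - Real.exp (-t))
  have h3 : 1 - Real.exp (-t) ≠ 0 := by linarith
  convert h using 1
  · rfl
  · ext n
    field_simp
    exact (pow_succ' _ _).symm
  · rw [sub_sub_cancel, Real.log_exp, neg_neg]

lemma sum_alternating_choose_mul_pow {R : Type*} [CommRing R] (n : ℕ) (y : R) :
    ∑ k ∈ Finset.range (n + 1), (-1) ^ k * (n.choose k : R) * y ^ k = (1 - y) ^ n := by
  rw [sub_eq_neg_add, add_pow]
  refine Finset.sum_congr rfl fun k _ => ?_
  rw [neg_pow]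
  ring

lemma sum_alternating_choose_mul_succ_mul_pow (n : ℕ) (y : ℂ) :
    ∑ k ∈ Finset.range (n + 1), (-1) ^ k * (n.choose k : ℂ) * ((k : ℂ) + 1) * y ^ k =
      (1 - y) ^ n - n * y * (1 - y) ^ (n - 1) := by
  have h1 : HasDerivAt (fun y : ℂ => ∑ k ∈ Finset.range (n + 1),
      (-1) ^ k * (n.choose k : ℂ) * y ^ (k + 1))
      (∑ k ∈ Finset.range (n + 1), (-1) ^ k * (n.choose k : ℂ) *
        (((k + 1 : ℕ) : ℂ) * y ^ k)) y :=
    HasDerivAt.fun_sum fun k _ => (hasDerivAt_pow (k + 1) y).const_mul _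
  have h2 : HasDerivAt (fun y : ℂ => y * (1 - y) ^ n)
      (1 * (1 - y) ^ n + y * (n * (1 - y) ^ (n - 1) * (-1))) y :=
    (hasDerivAt_id y).mul (((hasDerivAt_id y).const_sub 1).pow n)
  have h3 : (fun y : ℂ => ∑ k ∈ Finset.range (n + 1),
      (-1) ^ k * (n.choose k : ℂ) * y ^ (k + 1)) = fun y => y * (1 - y) ^ n := by
    ext z
    rw [← sum_alternating_choose_mul_pow n z, Finset.mul_sum]
    exact Finset.sum_congr rfl fun k _ => by ring
  rw [h3] at h1
  have h4 := h1.unique h2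
  calc _ = ∑ k ∈ Finset.range (n + 1), (-1) ^ k * (n.choose k : ℂ) *
        (((k + 1 : ℕ) : ℂ) * y ^ k) :=
        Finset.sum_congr rfl fun k _ => by push_cast; ring
    _ = _ := by rw [h4]; ring

/-- Finite Dirichlet polynomials as Mellin transforms. -/
lemma mellin_sum_exp (N : ℕ) (a : ℕ → ℂ) {s : ℂ} (hs : 0 < s.re) :
    mellin (fun t : ℝ => ∑ k ∈ Finset.range N, a k * Complex.exp (-t) ^ (k + 1)) s =
      Complex.Gamma s * ∑ k ∈ Finset.range N, a k / (((k : ℝ) + 1 : ℝ) : ℂ) ^ s := by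
  have h := hasSum_mellin (ι := Fin N) (a := fun k => a k) (p := fun k => (k : ℝ) + 1)
    (F := fun t : ℝ => ∑ k ∈ Finset.range N, a k * Complex.exp (-t) ^ (k + 1)) (s := s)
    (fun k => .inr (by positivity)) hs (fun t _ => ?_) (hasSum_fintype _).summable
  · rw [h.unique (hasSum_fintype _), Finset.mul_sum,
      Fin.sum_univ_eq_sum_range
        (fun k => Complex.Gamma s * a k / (((k : ℝ) + 1 : ℝ) : ℂ) ^ s) N]
    exact Finset.sum_congr rfl fun k _ => mul_div_assoc _ _ _
  · rw [← Fin.sum_univ_eq_sum_range (fun k => a k * Complex.exp (-t) ^ (k + 1)) N]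
    convert hasSum_fintype _ using 4 with k
    push_cast
    rw [← Complex.exp_nat_mul]
    congr 1
    push_cast
    ring

lemma Gamma_mul_hasseTerm_zero (n : ℕ) {s : ℂ} (hs : 0 < s.re) :
    Complex.Gamma s * hasseTerm 0 n s =
      mellin (fun t : ℝ => (1 / ((n : ℂ) + 1)) * (Complex.exp (-t) * ((1 - Complex.exp (-t)) ^ n -
        n * Complex.exp (-t) * (1 - Complex.exp (-t)) ^ (n - 1)))) s := by
  have h := mellin_sum_exp (n + 1)
    (fun k => (1 / ((n : ℂ) + 1)) * ((-1) ^ k * (n.choose k : ℂ) * ((k : ℂ) + 1))) hs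
  rw [hasseTerm_zero]
  convert h.symm using 1
  · rw [Finset.mul_sum]
    congr 1
    refine Finset.sum_congr rfl fun k _ => ?_
    have hk : (((k : ℝ) + 1 : ℝ) : ℂ) ≠ 0 := by
      exact_mod_cast (by positivity : (k : ℝ) + 1 ≠ 0)
    rw [Complex.cpow_sub _ _ hk, Complex.cpow_one]
    push_cast
    ring
  · congr 1
    ext t
    rw [← sum_alternating_choose_mul_succ_mul_pow, Finset.mul_sum, Finset.mul_sum]
    exact Finset.sum_congr rfl fun k _ => by ring

lemma Gamma_sub_one_mul_hasseTerm_zero (n : ℕ) {s : ℂ} (hs : 1 < s.re) :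
    Complex.Gamma (s - 1) * hasseTerm 0 n s =
      mellin (fun t : ℝ => (1 / ((n : ℂ) + 1)) *
        (Complex.exp (-t) * (1 - Complex.exp (-t)) ^ n)) (s - 1) := by
  have h := mellin_sum_exp (n + 1)
    (fun k => (1 / ((n : ℂ) + 1)) * ((-1) ^ k * (n.choose k : ℂ))) (s := s - 1) (by simpa using hs)
  rw [hasseTerm_zero]
  convert h.symm using 1
  · rw [Finset.mul_sum]
    congr 1
    refine Finset.sum_congr rfl fun k _ => ?_
    rw [← neg_sub s 1, Complex.cpow_neg]
    ring
  · congr 1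
    ext t
    rw [← sum_alternating_choose_mul_pow, Finset.mul_sum, Finset.mul_sum]
    exact Finset.sum_congr rfl fun k _ => by ring

/-- A pointwise majorant for the density whose Mellin transform is `Γ(s) * hasseTerm 0 n s`. -/
lemma hasse_density_norm_le (n : ℕ) {t : ℝ} (ht : 0 < t) :
    ‖(1 / ((n : ℂ) + 1)) * (Complex.exp (-t) * ((1 - Complex.exp (-t)) ^ n -
        n * Complex.exp (-t) * (1 - Complex.exp (-t)) ^ (n - 1)))‖ ≤
      Real.exp (-t) * ((1 - Real.exp (-t)) ^ n / ((n : ℝ) + 1) +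
        Real.exp (-t) * (1 - Real.exp (-t)) ^ (n - 1)) := by
  have h1 : Real.exp (-t) < 1 := by simpa using ht
  have h2 := Real.exp_pos (-t)
  rw [show (1 / ((n : ℂ) + 1)) * (Complex.exp (-t) * ((1 - Complex.exp (-t)) ^ n -
        n * Complex.exp (-t) * (1 - Complex.exp (-t)) ^ (n - 1))) =
      (((1 / ((n : ℝ) + 1)) * (Real.exp (-t) * ((1 - Real.exp (-t)) ^ n -
        n * Real.exp (-t) * (1 - Real.exp (-t)) ^ (n - 1))) : ℝ) : ℂ) by push_cast; rfl,
    Complex.norm_real, Real.norm_eq_abs]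
  generalize Real.exp (-t) = y at *
  have hx : 0 ≤ 1 - y := by linarith
  have hA : 0 ≤ (1 - y) ^ n / ((n : ℝ) + 1) := by positivity
  have hB : 0 ≤ y * (1 - y) ^ (n - 1) := by positivity
  have hn : (n : ℝ) / (n + 1) ≤ 1 := by rw [div_le_one (by positivity)]; linarith
  have hn0 : 0 ≤ (n : ℝ) / (n + 1) := by positivity
  rw [show (1 / ((n : ℝ) + 1)) * (y * ((1 - y) ^ n - n * y * (1 - y) ^ (n - 1))) =
    y * ((1 - y) ^ n / ((n : ℝ) + 1) - (n : ℝ) / (n + 1) * (y * (1 - y) ^ (n - 1))) by ring,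
    abs_mul, abs_of_pos h2]
  refine mul_le_mul_of_nonneg_left ?_ h2.le
  rw [abs_le]
  constructor <;> nlinarith [mul_le_of_le_one_left hB hn, mul_nonneg hn0 hB]

lemma sum_hasse_weight_le (N : ℕ) {t : ℝ} (ht : 0 < t) :
    ∑ n ∈ Finset.range N, Real.exp (-t) * ((1 - Real.exp (-t)) ^ n / ((n : ℝ) + 1) +
        Real.exp (-t) * (1 - Real.exp (-t)) ^ (n - 1)) ≤ Real.exp (-t) * (3 + t) := by
  have h1 : Real.exp (-t) < 1 := by simpa using ht
  have h2 := Real.exp_pos (-t)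
  rw [← Finset.mul_sum, Finset.sum_add_distrib, ← Finset.mul_sum]
  refine mul_le_mul_of_nonneg_left ?_ h2.le
  have hA := (sum_le_hasSum (Finset.range N) (fun n _ => by
    have : 0 ≤ 1 - Real.exp (-t) := by linarith
    positivity) (hasSum_one_sub_exp_neg_pow_div ht)).trans (mul_exp_neg_div_le ht)
  have hB : Real.exp (-t) * ∑ n ∈ Finset.range N, (1 - Real.exp (-t)) ^ (n - 1) ≤ 2 := by
    generalize Real.exp (-t) = y at *
    have hx : 0 ≤ 1 - y := by linarith
    cases N with
    | zero => simp
    | succ M =>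
      rw [Finset.sum_range_succ']
      simp only [Nat.add_sub_cancel, Nat.zero_sub, pow_zero]
      have h3 := mul_neg_geom_sum (1 - y) M
      rw [sub_sub_cancel] at h3
      rw [mul_add, h3]
      linarith [pow_nonneg hx M]
  linarith

/-- A summable majorant of `Γ(s) * hasseTerm 0 n s`, uniform on vertical strips. -/
lemma exists_summable_bound_Gamma_mul_hasseTerm {a b : ℝ} (ha : 0 < a) (hb : 0 < b) :
    ∃ M : ℕ → ℝ, Summable M ∧ ∀ n (s : ℂ), a ≤ s.re → s.re ≤ b →
      ‖Complex.Gamma s * hasseTerm 0 n s‖ ≤ M n := by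
  obtain ⟨hi, hsum⟩ := summable_integral_of_sum_range_le (μ := volume.restrict (Set.Ioi 0))
    (F := fun n t => (t ^ (a - 1) + t ^ (b - 1)) *
      (Real.exp (-t) * ((1 - Real.exp (-t)) ^ n / ((n : ℝ) + 1) +
        Real.exp (-t) * (1 - Real.exp (-t)) ^ (n - 1))))
    (b := fun t => t ^ (a - 1) * (Real.exp (-t) * (3 + t)) +
      t ^ (b - 1) * (Real.exp (-t) * (3 + t)))
    (fun n => by
      apply Measurable.aestronglyMeasurable
      fun_prop)
    (fun n => (ae_restrict_iff' measurableSet_Ioi).2 <| .of_forall fun t (ht : 0 < t) => by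
      have : 0 ≤ 1 - Real.exp (-t) := by simpa using ht.le
      positivity)
    ((integrableOn_rpow_mul_exp_neg_mul_add ha 3).add (integrableOn_rpow_mul_exp_neg_mul_add hb 3))
    (fun N => (ae_restrict_iff' measurableSet_Ioi).2 <| .of_forall fun t (ht : 0 < t) => by
      rw [← Finset.mul_sum, ← add_mul]
      exact mul_le_mul_of_nonneg_left (sum_hasse_weight_le N ht) (by positivity))
  refine ⟨_, hsum, fun n s has hsb => ?_⟩
  rw [Gamma_mul_hasseTerm_zero n (ha.trans_le has), mellin]
  refine norm_integral_le_of_norm_le (hi n) ?_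
  refine (ae_restrict_iff' measurableSet_Ioi).2 <| .of_forall fun t (ht : 0 < t) => ?_
  rw [norm_smul, Complex.norm_cpow_eq_rpow_re_of_pos ht]
  refine mul_le_mul ?_ (hasse_density_norm_le n ht) (norm_nonneg _) (by positivity)
  rw [Complex.sub_re, Complex.one_re]
  rcases le_total t 1 with h | h
  · exact (Real.rpow_le_rpow_of_exponent_ge ht h (by linarith)).trans
      (le_add_of_nonneg_right (by positivity))
  · exact (Real.rpow_le_rpow_of_exponent_le h (by linarith)).trans
      (le_add_of_nonneg_left (by positivity))

lemma mellin_exp_neg_div_one_sub_exp_neg {s : ℂ} (hs : 1 < s.re) :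
    mellin (fun t : ℝ => Complex.exp (-t) / (1 - Complex.exp (-t))) s =
      Complex.Gamma s * riemannZeta s := by
  have hsum : Summable fun n : ℕ => 1 / ((n : ℝ) + 1) ^ s.re := by
    simpa using (summable_nat_add_iff 1).2 (Real.summable_one_div_nat_rpow.2 hs)
  have h := hasSum_mellin (ι := ℕ) (a := fun _ => 1) (p := fun k => (k : ℝ) + 1)
    (F := fun t : ℝ => Complex.exp (-t) / (1 - Complex.exp (-t))) (s := s)
    (fun k => .inr (by positivity)) (by linarith) (fun t (ht : 0 < t) => ?_) (by simpa using hsum)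
  · rw [← h.tsum_eq, zeta_eq_tsum_one_div_nat_add_one_cpow hs, ← tsum_mul_left]
    refine tsum_congr fun n => ?_
    push_cast
    ring
  · have hg := (hasSum_geometric_of_norm_lt_one (ξ := Complex.exp (-t))
      (by rw [Complex.norm_exp]; simpa using ht)).mul_left (Complex.exp (-t))
    rw [← div_eq_mul_inv] at hg
    refine (congrArg (HasSum · _) (funext fun k => ?_)).mpr hg
    rw [← Complex.exp_nat_mul, ← Complex.exp_add]
    push_cast
    rw [one_mul]
    congr 1
    ring

lemma hasSum_hasseTerm_zero {s : ℂ} (hs : 1 < s.re) :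
    HasSum (fun n => hasseTerm 0 n s) ((s - 1) * riemannZeta s) := by
  set F : ℕ → ℝ → ℂ := fun n t => (t : ℂ) ^ (s - 1 - 1) • ((1 / ((n : ℂ) + 1)) *
        (Complex.exp (-t) * (1 - Complex.exp (-t)) ^ n)) with hF
  have hnorm (n : ℕ) {t : ℝ} (ht : 0 < t) : ‖F n t‖ = t ^ (s.re - 1 - 1) *
      (Real.exp (-t) * ((1 - Real.exp (-t)) ^ n / ((n : ℝ) + 1))) := by
    have h1 : 0 ≤ 1 - Real.exp (-t) := by simpa using ht.le
    rw [hF, norm_smul, Complex.norm_cpow_eq_rpow_re_of_pos ht,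
      show (1 / ((n : ℂ) + 1)) * (Complex.exp (-t) * (1 - Complex.exp (-t)) ^ n) =
        ((Real.exp (-t) * ((1 - Real.exp (-t)) ^ n / ((n : ℝ) + 1)) : ℝ) : ℂ) by
        push_cast; ring, Complex.norm_real, Real.norm_of_nonneg (by positivity)]
    simp
  have hmeas (n : ℕ) : Measurable (F n) := by
    simp only [hF, smul_eq_mul]
    fun_prop
  obtain ⟨hi, hsum⟩ := summable_integral_of_sum_range_le (μ := volume.restrict (Set.Ioi 0))
    (F := fun n t => ‖F n t‖)
    (b := fun t => t ^ (s.re - 1 - 1) * (Real.exp (-t) * (1 + t)))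
    (fun n => (hmeas n).norm.aestronglyMeasurable)
    (fun n => .of_forall fun t => norm_nonneg _)
    (integrableOn_rpow_mul_exp_neg_mul_add (sub_pos.2 hs) 1)
    (fun N => (ae_restrict_iff' measurableSet_Ioi).2 <| .of_forall fun t (ht : 0 < t) => by
      have h1 : 0 ≤ 1 - Real.exp (-t) := by simpa using ht.le
      simp only [hnorm _ ht]
      rw [← Finset.mul_sum, ← Finset.mul_sum]
      gcongr
      exact (sum_le_hasSum (Finset.range N) (fun n _ => by positivity)
        (hasSum_one_sub_exp_neg_pow_div ht)).trans (mul_exp_neg_div_le ht))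
  have key := hasSum_integral_of_summable_integral_norm
    (fun n => (integrable_norm_iff (hmeas n).aestronglyMeasurable).1 (hi n)) hsum
  have hΓ : Complex.Gamma (s - 1) ≠ 0 := Complex.Gamma_ne_zero_of_re_pos (by simpa using hs)
  have hs1 : s - 1 ≠ 0 := fun h => by
    have := congrArg Complex.re h
    simp at this
    linarith
  have hlim : ∫ t in Set.Ioi (0 : ℝ), ∑' n, F n t =
      Complex.Gamma (s - 1) * ((s - 1) * riemannZeta s) := by
    have hG : Complex.Gamma s = (s - 1) * Complex.Gamma (s - 1) := by
      simpa using Complex.Gamma_add_one (s - 1) hs1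
    have hz := mellin_exp_neg_div_one_sub_exp_neg hs
    rw [hG] at hz
    rw [← mul_assoc, mul_comm (Complex.Gamma _), ← hz, mellin]
    refine setIntegral_congr_fun measurableSet_Ioi fun t (ht : 0 < t) => ?_
    have hp := Complex.hasSum_ofReal.2 (hasSum_one_sub_exp_neg_pow_div ht)
    have hq := hp.mul_left ((t : ℂ) ^ (s - 1 - 1) * Complex.exp (-t))
    have htc : (t : ℂ) ≠ 0 := by exact_mod_cast ht.ne'
    have hFq (n : ℕ) : F n t = (t : ℂ) ^ (s - 1 - 1) * Complex.exp (-t) *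
        (((1 - Real.exp (-t)) ^ n / ((n : ℝ) + 1) : ℝ) : ℂ) := by
      simp only [hF, smul_eq_mul]
      push_cast
      ring
    simp only [hFq]
    rw [hq.tsum_eq, Complex.cpow_sub _ 1 htc, Complex.cpow_one, smul_eq_mul]
    push_cast
    field_simp
  rw [hlim] at key
  have := key.mul_left (Complex.Gamma (s - 1))⁻¹
  rw [inv_mul_cancel_left₀ hΓ] at this
  refine (congrArg (HasSum · _) (funext fun n => ?_)).mpr this
  rw [eq_inv_mul_iff_mul_eq₀ hΓ, Gamma_sub_one_mul_hasseTerm_zero n hs, mellin]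

/-- Hasse's series converges locally uniformly to `(s-1) ζ(s)` around `s = 1`. -/
lemma tendstoLocallyUniformlyOn_sum_hasseTerm {E : ℂ → ℂ} (hE : Differentiable ℂ E)
    (hEz : ∀ s : ℂ, 1 < s.re → E s = (s - 1) * riemannZeta s) :
    TendstoLocallyUniformlyOn (fun N s => ∑ n ∈ Finset.range N, hasseTerm 0 n s) E atTop
      (Metric.ball (3 / 2) 1) := by
  have hre {s : ℂ} (hs : s ∈ Metric.ball (3 / 2 : ℂ) 1) : 1 / 2 ≤ s.re ∧ s.re ≤ 5 / 2 := by
    rw [Metric.mem_ball, dist_eq_norm] at hs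
    have := abs_le.1 ((Complex.abs_re_le_norm _).trans hs.le)
    norm_num at this
    constructor <;> linarith
  obtain ⟨M, hM, hMb⟩ := exists_summable_bound_Gamma_mul_hasseTerm
    (a := 1 / 2) (b := 5 / 2) (by norm_num) (by norm_num)
  obtain ⟨C, hC⟩ := (isCompact_closedBall (3 / 2 : ℂ) 1).exists_bound_of_continuousOn
    Complex.differentiable_one_div_Gamma.continuous.continuousOn
  have hbound (n : ℕ) (s : ℂ) (hs : s ∈ Metric.ball (3 / 2 : ℂ) 1) :
      ‖hasseTerm 0 n s‖ ≤ C * M n := by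
    have hΓ : Complex.Gamma s ≠ 0 :=
      Complex.Gamma_ne_zero_of_re_pos (by linarith [(hre hs).1])
    have h1 := hC s (Metric.ball_subset_closedBall hs)
    rw [← inv_mul_cancel_left₀ hΓ (hasseTerm 0 n s), norm_mul]
    exact mul_le_mul h1 (hMb n s (hre hs).1 (hre hs).2) (norm_nonneg _)
      ((norm_nonneg _).trans h1)
  have hT := (tendstoUniformlyOn_tsum_nat (hM.mul_left C) hbound).tendstoLocallyUniformlyOn
  refine hT.congr_right ?_
  have hd := hT.differentiableOn (.of_forall fun N s _ =>
    (HasDerivAt.fun_sum fun n _ =>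
      hasDerivAt_hasseTerm 0 n s).differentiableAt.differentiableWithinAt) Metric.isOpen_ball
  refine (hd.analyticOnNhd Metric.isOpen_ball).eqOn_of_preconnected_of_eventuallyEq
    (hE.differentiableOn.analyticOnNhd Metric.isOpen_ball)
    (convex_ball _ _).isPreconnected (Metric.mem_ball_self one_pos) ?_
  filter_upwards [(isOpen_lt continuous_const Complex.continuous_re).mem_nhds
    (show (1 : ℝ) < (3 / 2 : ℂ).re by norm_num)] with s hs
  rw [(hasSum_hasseTerm_zero hs).tsum_eq, hEz s hs]

lemma iteratedDeriv_succ_one_add_sub_mul {g : ℂ → ℂ} (hg : Differentiable ℂ g) (a : ℂ) (m : ℕ) :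
    iteratedDeriv (m + 1) (fun s => 1 + (s - a) * g s) =
      fun s => (s - a) * iteratedDeriv (m + 1) g s + (m + 1) * iteratedDeriv m g s := by
  have hd (j : ℕ) (s : ℂ) : HasDerivAt (iteratedDeriv j g) (iteratedDeriv (j + 1) g s) s := by
    rw [iteratedDeriv_succ]
    exact (hg.contDiff.differentiable_iteratedDeriv j
      (WithTop.coe_lt_top _)).differentiableAt.hasDerivAt
  induction m with
  | zero =>
    ext s
    rw [zero_add, iteratedDeriv_one]
    have h := (((hasDerivAt_id s).sub_const a).mul (hd 0 s)).const_add 1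
    simp only [iteratedDeriv_zero] at h
    refine (HasDerivAt.deriv h).trans ?_
    simp
    ring
  | succ m ih =>
    ext s
    rw [iteratedDeriv_succ, ih]
    have h := (((hasDerivAt_id s).sub_const a).mul (hd (m + 1) s)).add
      ((hd m s).const_mul ((m : ℂ) + 1))
    refine (HasDerivAt.deriv h).trans ?_
    simp
    ring

end HasseSeries

/-- The series representation of the Stieltjes constants derived from Hasse's series:
if `g` is the entire function agreeing with `ζ(s) − 1/(s−1)` away from `1`, then the
`m`-th Stieltjes constant `γ_m = (−1)^m g^{(m)}(1)` satisfies
`γ_m = −(1/(m+1)) Σ_{n=0}^∞ (1/(n+1)) Σ_{k=0}^n (−1)^k C(n,k) (ln(k+1))^{m+1}`,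
the outer series being convergent. -/
theorem stieltjes_hasse_series (m : ℕ) (g : ℂ → ℂ) (hg : Differentiable ℂ g)
    (hgz : ∀ s : ℂ, s ≠ 1 → g s = riemannZeta s - 1 / (s - 1)) :
    ∃ L : ℂ,
      Tendsto (fun N : ℕ => ∑ n ∈ Finset.range N, (1 / ((n : ℂ) + 1)) *
          ∑ k ∈ Finset.range (n + 1), (-1) ^ k * (n.choose k : ℂ) *
            (Complex.ofReal (Real.log ((k : ℝ) + 1))) ^ (m + 1))
        atTop (nhds L) ∧
      (-1) ^ m * iteratedDeriv m g 1 = -(1 / ((m : ℂ) + 1)) * L := by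
  have hE : Differentiable ℂ fun s => 1 + (s - 1) * g s := by fun_prop
  have hEz (s : ℂ) (hs : 1 < s.re) : 1 + (s - 1) * g s = (s - 1) * riemannZeta s := by
    have hs1 : s ≠ 1 := fun h => by simp [h] at hs
    have hs2 : s - 1 ≠ 0 := sub_ne_zero.2 hs1
    rw [hgz s hs1]
    field_simp
    ring
  have hlim := (sum_hasseTerm_deriv_tendsto Metric.isOpen_ball
    (tendstoLocallyUniformlyOn_sum_hasseTerm hE hEz) (m + 1)).tendsto_at
    (show (1 : ℂ) ∈ Metric.ball (3 / 2) 1 by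
      rw [Metric.mem_ball, dist_eq_norm]; norm_num)
  rw [iteratedDeriv_succ_one_add_sub_mul hg 1 m] at hlim
  refine ⟨_, (hlim.const_mul ((-1) ^ (m + 1))).congr fun N => ?_, ?_⟩
  · rw [Finset.mul_sum]
    refine Finset.sum_congr rfl fun n _ => ?_
    rw [hasseTerm, mul_left_comm, Finset.mul_sum]
    congr 1
    refine Finset.sum_congr rfl fun k _ => ?_
    rw [sub_self, mul_zero, Complex.exp_zero, mul_one, mul_left_comm, ← mul_pow, neg_one_mul,
      neg_neg]
  · have hm : (m : ℂ) + 1 ≠ 0 := by exact_mod_cast m.succ_ne_zero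
    simp only [sub_self, zero_mul, zero_add]
    field_simp
    ring
end
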